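/- arXiv:1703.07624 — 3 statements merged into one kernel-verified Lean document; each statement's English description precedes it below -/
import Mathlib

section
/- Let h = (h₁,…,hₙ) be a reduced self-vanishing system of forms in K[x₁,…,xₙ] (so not all hⱼ are zero). Then the common degree of the hⱼ is 0 (i.e., h is a constant vector in Kⁿ) if and only if h₁,…,hₙ have no common zero in Kⁿ ∖ {0}. In particular, every self-vanishing system of forms of positive common degree with h ≠ 0 has a common zero a ∈ Kⁿ with a ≠ 0. -/
open MvPolynomial

namespace Derivation

variable {R A : Type*} [CommRing R] [CommRing A] [Algebra R A]

/-- Leibniz rule for an iterated derivation, when the first factor is killed by `D ^ 2`. -/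
theorem toLinearMap_pow_succ_mul (D : Derivation R A A) {x : A} (hx : D (D x) = 0) (g : A)
    (k : ℕ) :
    ((D : A →ₗ[R] A) ^ (k + 1)) (x * g) =
      x * ((D : A →ₗ[R] A) ^ (k + 1)) g + (k + 1) * (D x * ((D : A →ₗ[R] A) ^ k) g) := by
  induction k with
  | zero => simp; ring
  | succ k ih =>
    have hk : D ((k : A) + 1) = 0 := by simp
    rw [pow_succ', Module.End.mul_apply, ih, Module.End.mul_apply]
    have hkk : D (((D : A →ₗ[R] A) ^ k) g) = ((D : A →ₗ[R] A) ^ (k + 1)) g := by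
      rw [pow_succ', Module.End.mul_apply, coeFn_coe]
    simp only [coeFn_coe, map_add, leibniz, smul_eq_mul, hx, hk, hkk, Nat.cast_add, Nat.cast_one]
    ring

end Derivation

namespace MvPolynomial

variable {σ R : Type*} [CommRing R]

theorem mkDerivation_eq_sum_mul_pderiv [Fintype σ] (h : σ → MvPolynomial σ R)
    (f : MvPolynomial σ R) : mkDerivation R h f = ∑ i, h i * pderiv i f := by
  classical
  induction f using MvPolynomial.induction_on with
  | C a => simp
  | add p q hp hq => simp [hp, hq, mul_add, Finset.sum_add_distrib]
  | mul_X p i hp =>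
    simp only [Derivation.leibniz, mkDerivation_X, smul_eq_mul, hp, pderiv_X, mul_add,
      Finset.sum_add_distrib, Finset.mul_sum]
    simp only [Pi.single_apply, mul_ite, mul_one, mul_zero, Finset.sum_ite_eq,
      Finset.mem_univ, if_true]
    congr 1
    · simp [mul_comm]
    · exact Finset.sum_congr rfl fun _ _ => by ring

theorem derivation_aeval_eq_zero {A τ : Type*} [CommRing A] [Algebra R A] (D : Derivation R A A)
    {h : τ → A} (hD : ∀ i, D (h i) = 0) (f : MvPolynomial τ R) : D (aeval h f) = 0 := by
  induction f using MvPolynomial.induction_on with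
  | C a => simp
  | add p q hp hq => simp [hp, hq]
  | mul_X p i hp => simp [hp, hD]

/-- If `D` is a derivation of a polynomial ring with `D ^ 2` killing the variables, then
`D ^ k` acts on a form `f` of degree `k` as `k!` times substitution of `D xᵢ` for `xᵢ`. -/
theorem IsHomogeneous.derivation_pow_apply {K : Type*} [Field K] [CharZero K] [Fintype σ]
    (D : Derivation K (MvPolynomial σ K) (MvPolynomial σ K)) (hD : ∀ i, D (D (X i)) = 0)
    {k : ℕ} {f : MvPolynomial σ K} (hf : f.IsHomogeneous k) :
    ((D : MvPolynomial σ K →ₗ[K] MvPolynomial σ K) ^ k) f =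
      (k.factorial : MvPolynomial σ K) * MvPolynomial.aeval (fun i => D (X i)) f := by
  induction k generalizing f with
  | zero =>
    rw [totalDegree_eq_zero_iff_eq_C.mp ((totalDegree_zero_iff_isHomogeneous _).mpr hf)]
    simp [algebraMap_eq]
  | succ k ih =>
    have euler := hf.sum_X_mul_pderiv
    have hdeg (i : σ) : (pderiv i f).IsHomogeneous k := hf.pderiv
    have kill (i : σ) :
        ((D : MvPolynomial σ K →ₗ[K] MvPolynomial σ K) ^ (k + 1)) (pderiv i f) = 0 := by
      rw [pow_succ', Module.End.mul_apply, ih (hdeg i)]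
      rw [Derivation.coeFn_coe, Derivation.leibniz, derivation_aeval_eq_zero D hD,
        Derivation.map_natCast, smul_zero, smul_zero, add_zero]
    have hD_euler := congrArg ((D : MvPolynomial σ K →ₗ[K] MvPolynomial σ K) ^ (k + 1)) euler
    have heval := congrArg (MvPolynomial.aeval fun i => D (X i)) euler
    simp only [map_sum, map_nsmul, map_mul, aeval_X] at heval
    simp only [map_sum, map_nsmul, Derivation.toLinearMap_pow_succ_mul D (hD _), kill, ih (hdeg _),
      mul_zero, zero_add] at hD_euler
    rw [nsmul_eq_mul] at heval hD_euler
    have hk : ((k + 1 : ℕ) : MvPolynomial σ K) ≠ 0 := Nat.cast_ne_zero.mpr k.succ_ne_zero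
    refine mul_left_cancel₀ hk ?_
    rw [← hD_euler, mul_left_comm, ← heval, Finset.mul_sum]
    refine Finset.sum_congr rfl fun i _ => ?_
    rw [Nat.factorial_succ]
    push_cast
    ring

/-- A self-vanishing system of forms of positive degree vanishes at its own values. -/
theorem aeval_self_eq_zero_of_selfVanishing {K : Type*} [Field K] [CharZero K] [Fintype σ]
    {h : σ → MvPolynomial σ K} {e : ℕ} (he : 0 < e) (hh : ∀ j, (h j).IsHomogeneous e)
    (hsv : ∀ j, ∑ i, h i * pderiv i (h j) = 0) (j : σ) : aeval h (h j) = 0 := by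
  have hD (i : σ) : mkDerivation K h (h i) = 0 := by
    rw [mkDerivation_eq_sum_mul_pderiv, hsv]
  have hpow := (hh j).derivation_pow_apply (mkDerivation K h) fun i => by
    rw [mkDerivation_X, hD]
  obtain ⟨k, rfl⟩ := Nat.exists_eq_add_one.mpr he
  rw [pow_succ, Module.End.mul_apply, Derivation.coeFn_coe, hD, map_zero] at hpow
  simpa [Nat.factorial_ne_zero] using hpow.symm

theorem exists_common_zero_of_selfVanishing {K : Type*} [Field K] [CharZero K] [Fintype σ]
    {h : σ → MvPolynomial σ K} {e : ℕ} (he : 0 < e) (hh : ∀ j, (h j).IsHomogeneous e)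
    (hsv : ∀ j, ∑ i, h i * pderiv i (h j) = 0) (hne : h ≠ 0) :
    ∃ a : σ → K, a ≠ 0 ∧ ∀ j, eval a (h j) = 0 := by
  obtain ⟨j, hj⟩ := Function.ne_iff.mp hne
  obtain ⟨x, hx⟩ : ∃ x, eval x (h j) ≠ 0 := by
    by_contra! hzero
    exact hj (funext fun x => by simp [hzero x])
  refine ⟨fun i => eval x (h i), fun h0 => hx (congrFun h0 j), fun i => ?_⟩
  have hi := congrArg (aeval x) (aeval_self_eq_zero_of_selfVanishing he hh hsv i)
  rw [map_zero, ← AlgHom.comp_apply, comp_aeval] at hi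
  simpa [aeval_eq_eval] using hi

end MvPolynomial

/-- A reduced self-vanishing system of forms `h ≠ 0` is a constant vector if and only if
`h₁,…,hₙ` have no common nontrivial zero.  In particular, every self-vanishing system of
forms of positive common degree which is not identically zero has a common zero
`a ∈ Kⁿ, a ≠ 0`. -/
theorem reduced_svs_constant_iff_no_common_zero
    {K : Type*} [Field K] [IsAlgClosed K] [CharZero K] {n : ℕ}
    (h : Fin n → MvPolynomial (Fin n) K) (e : ℕ)
    (hh : ∀ j, (h j).IsHomogeneous e)
    (hsv : ∀ j, ∑ i, h i * pderiv i (h j) = 0)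
    (hred : ∀ p : MvPolynomial (Fin n) K, (∀ j, p ∣ h j) → IsUnit p)
    (hne : h ≠ 0) :
    ((∃ c : Fin n → K, ∀ j, h j = C (c j)) ↔
      ¬∃ a : Fin n → K, a ≠ 0 ∧ ∀ j, eval a (h j) = 0) ∧
    (∀ (h' : Fin n → MvPolynomial (Fin n) K) (e' : ℕ), 0 < e' →
      (∀ j, (h' j).IsHomogeneous e') →
      (∀ j, ∑ i, h' i * pderiv i (h' j) = 0) →
      h' ≠ 0 →
      ∃ a : Fin n → K, a ≠ 0 ∧ ∀ j, eval a (h' j) = 0) := by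
  have key : ∀ (h' : Fin n → MvPolynomial (Fin n) K) (e' : ℕ), 0 < e' →
      (∀ j, (h' j).IsHomogeneous e') →
      (∀ j, ∑ i, h' i * pderiv i (h' j) = 0) →
      h' ≠ 0 →
      ∃ a : Fin n → K, a ≠ 0 ∧ ∀ j, eval a (h' j) = 0 :=
    fun _ _ he hhom hvan hne' => exists_common_zero_of_selfVanishing he hhom hvan hne'
  refine ⟨⟨?_, fun hnz => ?_⟩, key⟩
  · rintro ⟨c, hc⟩ ⟨a, -, ha⟩
    refine hne (funext fun j => ?_)
    have hj := ha j
    rw [hc j, eval_C] at hj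
    rw [hc j, hj, C_0, Pi.zero_apply]
  · obtain rfl | he := Nat.eq_zero_or_pos e
    · exact ⟨fun j => (h j).coeff 0, fun j =>
        totalDegree_eq_zero_iff_eq_C.mp ((totalDegree_zero_iff_isHomogeneous _).mpr (hh j))⟩
    · exact absurd (key h e he hh hsv hne) hnz
end

section
/- Let n ≥ 4 and let h = (h₁,…,hₙ) be a reduced self-vanishing system of forms of positive common degree in K[x₁,…,xₙ]. Then n/2 ≤ KrullDim( K[x₁,…,xₙ]/(h₁,…,hₙ) ) ≤ n−2, where (h₁,…,hₙ) denotes the ideal generated by h₁,…,hₙ. -/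
open MvPolynomial

/-- The one-parameter substitution `xᵢ ↦ xᵢ + t hᵢ`. -/
noncomputable def flow {K : Type*} [Field K] {n : ℕ} (h : Fin n → MvPolynomial (Fin n) K) :
    MvPolynomial (Fin n) K →ₐ[K] Polynomial (MvPolynomial (Fin n) K) :=
  aeval fun i => Polynomial.C (X i) + Polynomial.X * Polynomial.C (h i)

section flow

variable {K : Type*} [Field K] {n : ℕ} (h : Fin n → MvPolynomial (Fin n) K)

lemma flow_C (a : K) : flow h (C a) = Polynomial.C (C a) := by
  simp [flow, algHom_C, Polynomial.algebraMap_apply, MvPolynomial.algebraMap_eq]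

lemma flow_X (i : Fin n) :
    flow h (X i) = Polynomial.C (X i) + Polynomial.X * Polynomial.C (h i) := by
  simp [flow]

lemma derivative_flow (f : MvPolynomial (Fin n) K) :
    Polynomial.derivative (flow h f) = ∑ i, flow h (pderiv i f) * Polynomial.C (h i) := by
  induction f using MvPolynomial.induction_on with
  | C a => simp
  | add p q hp hq => simp [hp, hq, add_mul, Finset.sum_add_distrib]
  | mul_X p j hp =>
    have hj : Polynomial.derivative (flow h (X j)) = Polynomial.C (h j) := by simp [flow_X]
    have hterm (i : Fin n) : flow h (pderiv i (p * X j)) * Polynomial.C (h i) =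
        (if i = j then flow h p * Polynomial.C (h j) else 0) +
          flow h (pderiv i p) * Polynomial.C (h i) * flow h (X j) := by
      rw [pderiv_mul, map_add, map_mul, map_mul, pderiv_X]
      by_cases hij : i = j
      · subst hij
        simp only [Pi.single_eq_same, map_one, if_true]
        ring
      · simp only [Pi.single_eq_of_ne' hij, map_zero, if_neg hij]
        ring
    rw [map_mul, Polynomial.derivative_mul, hp, hj, Finset.sum_congr rfl fun i _ => hterm i,
      Finset.sum_add_distrib, Finset.sum_ite_eq' Finset.univ j, if_pos (Finset.mem_univ j),
      Finset.sum_mul, add_comm]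

lemma coeff_zero_flow (f : MvPolynomial (Fin n) K) : (flow h f).coeff 0 = f := by
  induction f using MvPolynomial.induction_on with
  | C a => simp
  | add p q hp hq => simp [hp, hq]
  | mul_X p j hp => simp [hp, flow_X, Polynomial.mul_coeff_zero]

/-- The entries of a self-vanishing system are constant along its flow. -/
lemma flow_eq_C_of_self_vanishing [CharZero K]
    (hsv : ∀ j, ∑ i, h i * pderiv i (h j) = 0) (j : Fin n) :
    flow h (h j) = Polynomial.C (h j) := by
  have key : ∀ k : ℕ, ∀ j, Polynomial.X ^ k ∣ flow h (h j) - Polynomial.C (h j) := by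
    intro k
    induction k with
    | zero => simp
    | succ k ih =>
      intro j
      have hder : Polynomial.derivative (flow h (h j) - Polynomial.C (h j)) =
          -∑ i, flow h (pderiv i (h j)) * (flow h (h i) - Polynomial.C (h i)) := by
        have h0 : ∑ i, flow h (pderiv i (h j)) * flow h (h i) = 0 := by
          rw [← map_zero (flow h), ← hsv j, map_sum]
          exact Finset.sum_congr rfl fun i _ => by rw [map_mul, mul_comm]
        simp [derivative_flow, mul_sub, Finset.sum_sub_distrib, h0]
      have hdvd : Polynomial.X ^ k ∣
          Polynomial.derivative (flow h (h j) - Polynomial.C (h j)) := by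
        rw [hder]
        exact (Finset.dvd_sum fun i _ => (ih i).mul_left _).neg_right
      rw [Polynomial.X_pow_dvd_iff] at hdvd ⊢
      rintro (_ | m) hm
      · simp [coeff_zero_flow]
      · have := hdvd m (by omega)
        rw [Polynomial.coeff_derivative] at this
        exact (mul_eq_zero.mp this).resolve_right (by exact_mod_cast m.succ_ne_zero)
  rw [← sub_eq_zero]
  ext1 d
  exact Polynomial.X_pow_dvd_iff.mp (key (d + 1) j) d (Nat.lt_succ_self d)

lemma natDegree_prod_flow_X_pow_le_and_coeff (d : Fin n →₀ ℕ) (s : Finset (Fin n)) :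
    (∏ i ∈ s, flow h (X i) ^ d i).natDegree ≤ ∑ i ∈ s, d i ∧
      (∏ i ∈ s, flow h (X i) ^ d i).coeff (∑ i ∈ s, d i) = ∏ i ∈ s, h i ^ d i := by
  induction s using Finset.induction_on with
  | empty => simp
  | insert a s ha ih =>
    have h1 : (flow h (X a)).natDegree ≤ 1 := by
      rw [flow_X]
      compute_degree
    have h2 : (flow h (X a) ^ d a).natDegree ≤ d a := by
      simpa using Polynomial.natDegree_pow_le_of_le (d a) h1
    have h3 : (flow h (X a) ^ d a).coeff (d a) = h a ^ d a := by
      have := Polynomial.coeff_pow_of_natDegree_le (m := d a) h1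
      rw [mul_one] at this
      rw [this, flow_X]
      simp [Polynomial.coeff_C]
    simp only [Finset.prod_insert ha, Finset.sum_insert ha]
    exact ⟨Polynomial.natDegree_mul_le_of_le h2 ih.1, by
      rw [Polynomial.coeff_mul_add_eq_of_natDegree_le h2 ih.1, h3, ih.2]⟩

lemma coeff_flow_of_isHomogeneous {f : MvPolynomial (Fin n) K} {e : ℕ} (hf : f.IsHomogeneous e) :
    (flow h f).coeff e = aeval h f := by
  conv_lhs => rw [f.as_sum]
  conv_rhs => rw [f.as_sum]
  simp only [map_sum, Polynomial.finsetSum_coeff]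
  refine Finset.sum_congr rfl fun d hd => ?_
  have hde : e = ∑ i, d i := by
    rw [hf.degree_eq_sum_deg_support hd, ← Finsupp.degree_eq_sum, Finsupp.degree_apply]
  rw [monomial_eq, map_mul, map_mul, flow_C, Polynomial.coeff_C_mul, aeval_C,
    MvPolynomial.algebraMap_eq, Finsupp.prod_fintype _ _ (by simp)]
  simp only [map_prod, map_pow, aeval_X]
  rw [hde, (natDegree_prod_flow_X_pow_le_and_coeff h d Finset.univ).2]

/-- A self-vanishing system of forms of positive degree satisfies `h ∘ h = 0`. -/
lemma aeval_self_eq_zero_of_self_vanishing [CharZero K] {e : ℕ} (he : 0 < e)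
    (hh : ∀ j, (h j).IsHomogeneous e) (hsv : ∀ j, ∑ i, h i * pderiv i (h j) = 0) (j : Fin n) :
    aeval h (h j) = 0 := by
  rw [← coeff_flow_of_isHomogeneous h (hh j), flow_eq_C_of_self_vanishing h hsv j,
    Polynomial.coeff_C_of_ne_zero he.ne']

end flow

lemma MvPolynomial.le_height_ker_aeval_zero {K : Type*} [Field K] (n : ℕ) :
    (n : ℕ∞) ≤
      (RingHom.ker (aeval (0 : Fin n → K) : MvPolynomial (Fin n) K →ₐ[K] K)).height := by
  let φ (k : ℕ) : MvPolynomial (Fin n) K →ₐ[K] MvPolynomial (Fin n) K :=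
    aeval fun i : Fin n => if (i : ℕ) < k then 0 else X i
  have hlt (k : ℕ) (hk : k < n) : RingHom.ker (φ k) < RingHom.ker (φ (k + 1)) := by
    refine lt_of_le_of_ne (fun f hf => ?_) fun heq => ?_
    · have hcomp : (φ (k + 1)).comp (φ k) = φ (k + 1) := by
        ext1 i
        by_cases hi : (i : ℕ) < k
        · simp [φ, hi, hi.le]
        · simp [φ, hi]
      rw [RingHom.mem_ker] at hf ⊢
      rw [← hcomp, AlgHom.comp_apply, hf, map_zero]
    · have hmem : (X ⟨k, hk⟩ : MvPolynomial (Fin n) K) ∈ RingHom.ker (φ (k + 1)) := by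
        simp [φ, RingHom.mem_ker]
      rw [← heq] at hmem
      simp [φ, RingHom.mem_ker] at hmem
  have hheight (k : ℕ) (hk : k ≤ n) : (k : ℕ∞) ≤ (RingHom.ker (φ k)).height := by
    induction k with
    | zero => simp
    | succ k ih =>
      have := RingHom.ker_isPrime (φ k)
      have := RingHom.ker_isPrime (φ (k + 1))
      push_cast
      exact (add_le_add_left (ih (by omega)) 1).trans
        (Ideal.height_add_one_le_of_lt_of_isPrime (hlt k (by omega)))
  refine (hheight n le_rfl).trans (Ideal.height_mono fun f hf => ?_)
  have hcomp : (aeval (0 : Fin n → K)).comp (φ n) = aeval (0 : Fin n → K) := by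
    ext1 i
    simp [φ]
  rw [RingHom.mem_ker] at hf ⊢
  rw [← hcomp, AlgHom.comp_apply, hf, map_zero]

/-- If every prime containing `I` has height at least `m`, then `m + dim R/I ≤ dim R`. -/
lemma ringKrullDim_quotient_le_of_le_height {R : Type*} [CommRing R] (I : Ideal R) {m d : ℕ}
    (hdim : ringKrullDim R ≤ d) (hI : ∀ P : Ideal R, P.IsPrime → I ≤ P → (m : ℕ∞) ≤ P.height) :
    ringKrullDim (R ⧸ I) ≤ ((d - m : ℕ) : WithBot ℕ∞) := by
  rw [ringKrullDim_quotient, Order.krullDim]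
  refine iSup_le fun p => ?_
  have hstep (i : Fin (p.length + 1)) :
      ((m + i : ℕ) : ℕ∞) ≤ ((p i).1.asIdeal).height := by
    induction i using Fin.induction with
    | zero => simpa using hI _ (p 0).1.isPrime (p 0).2
    | succ i ih =>
      have hlt : (p i.castSucc).1.asIdeal < (p i.succ).1.asIdeal := p.step i
      refine le_trans ?_ (Ideal.height_add_one_le_of_lt_of_isPrime hlt)
      refine le_trans (le_of_eq ?_) (add_le_add_left ih 1)
      push_cast [Fin.val_succ]
      simp [add_assoc]
  have hlast : ((m + p.length : ℕ) : WithBot ℕ∞) ≤ d :=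
    (WithBot.coe_le_coe.mpr (hstep (Fin.last p.length))).trans
      (Ideal.height_le_ringKrullDim_of_isPrime.trans hdim)
  have : m + p.length ≤ d := by exact_mod_cast hlast
  exact_mod_cast (by omega : p.length ≤ d - m)

/-- In a UFD, a prime containing a family without nonunit common divisor has height at least
two. -/
lemma two_le_height_of_forall_dvd_isUnit {R ι : Type*} [CommRing R] [IsDomain R]
    [UniqueFactorizationMonoid R] {h : ι → R} (hne : ∃ j, h j ≠ 0)
    (hred : ∀ p : R, (∀ j, p ∣ h j) → IsUnit p) (P : Ideal R) [P.IsPrime]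
    (hP : Ideal.span (Set.range h) ≤ P) : (2 : ℕ∞) ≤ P.height := by
  have hmem (j : ι) : h j ∈ P := hP (Ideal.subset_span ⟨j, rfl⟩)
  by_contra! hlt
  have hle : P.height ≤ 1 := by
    rwa [← one_add_one_eq_two, ENat.lt_add_one_iff ENat.one_ne_top] at hlt
  have h0 : P.height ≠ 0 := by
    rw [Ne, Ideal.height_eq_zero_iff_eq_bot]
    rintro rfl
    exact hne.elim fun j hj => hj (by simpa using hmem j)
  have h1 : P.height = 1 := le_antisymm hle (Order.one_le_iff_pos.mpr (pos_iff_ne_zero.mpr h0))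
  obtain ⟨x, hx⟩ := (UniqueFactorizationMonoid.isPrincipal_of_height_eq_one h1).principal
  refine Ideal.IsPrime.ne_top ‹P.IsPrime› (Ideal.eq_top_of_isUnit_mem P (x := x) ?_ (hred x ?_))
  · rw [hx]; exact Submodule.mem_span_singleton_self x
  · intro j
    have := hmem j
    rw [hx] at this
    exact Ideal.mem_span_singleton.mp this

/-- If `h ∘ h = 0` then `K[x]/(h)` acts on `K[x]` through `h`, with fibre `K[x]/(h)` over the
origin, so that `n ≤ 2 dim K[x]/(h)`. -/
lemma le_ringKrullDim_quotient_add_self {K : Type*} [Field K] {n : ℕ}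
    (h : Fin n → MvPolynomial (Fin n) K) (h0 : ∀ j, aeval (0 : Fin n → K) (h j) = 0)
    (hcomp : ∀ j, aeval h (h j) = 0) :
    (n : WithBot ℕ∞) ≤
      ringKrullDim (MvPolynomial (Fin n) K ⧸ Ideal.span (Set.range h)) +
        ringKrullDim (MvPolynomial (Fin n) K ⧸ Ideal.span (Set.range h)) := by
  set I := Ideal.span (Set.range h) with hIdef
  let P : Ideal (MvPolynomial (Fin n) K) :=
    RingHom.ker (aeval (0 : Fin n → K) : MvPolynomial (Fin n) K →ₐ[K] K)
  have hPprime : P.IsPrime := RingHom.ker_isPrime _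
  let φ : MvPolynomial (Fin n) K ⧸ I →+* MvPolynomial (Fin n) K :=
    Ideal.Quotient.lift I (aeval h : MvPolynomial (Fin n) K →ₐ[K] _).toRingHom (by
      intro a ha
      have : I ≤ RingHom.ker (aeval h : MvPolynomial (Fin n) K →ₐ[K] _) := by
        rw [hIdef, Ideal.span_le]
        rintro _ ⟨j, rfl⟩
        exact hcomp j
      exact this ha)
  let := φ.toAlgebra
  let p : Ideal (MvPolynomial (Fin n) K ⧸ I) := P.comap φ
  have : P.LiesOver p := ⟨rfl⟩
  have hIle : I ≤ p.map φ := by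
    refine Ideal.span_le.mpr ?_
    rintro _ ⟨j, rfl⟩
    have hφ : φ (Ideal.Quotient.mk I (X j)) = h j := by simp [φ]
    rw [← hφ]
    refine Ideal.mem_map_of_mem φ ?_
    rw [Ideal.mem_comap, hφ]
    exact h0 j
  have hmapP : p.map φ ≤ P := Ideal.map_comap_le
  have hne : P.map (Ideal.Quotient.mk (p.map φ)) ≠ ⊤ := by
    have := Ideal.map_isPrime_of_surjective
      (Ideal.Quotient.mk_surjective (I := p.map φ)) (I := P) (by simpa [Ideal.mk_ker] using hmapP)
    exact this.ne_top
  have hfib : ((P.map (Ideal.Quotient.mk (p.map φ))).height : WithBot ℕ∞) ≤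
      ringKrullDim (MvPolynomial (Fin n) K ⧸ I) :=
    (Ideal.height_le_ringKrullDim_of_ne_top hne).trans
      (ringKrullDim_le_of_surjective _ (Ideal.Quotient.factor_surjective hIle))
  have hbase : (p.height : WithBot ℕ∞) ≤ ringKrullDim (MvPolynomial (Fin n) K ⧸ I) :=
    Ideal.height_le_ringKrullDim_of_isPrime
  have hsum := (MvPolynomial.le_height_ker_aeval_zero (K := K) n).trans
    (Ideal.height_le_height_add_of_liesOver p P)
  refine (WithBot.coe_le_coe.mpr hsum).trans ?_
  rw [WithBot.coe_add]
  exact add_le_add hbase hfib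


/-- For `n ≥ 4` and a reduced self-vanishing system `h` of forms of positive common
degree, the Krull dimension of `K[x₁,…,xₙ]/(h₁,…,hₙ)` lies between `n/2` and `n − 2`
(the lower bound `n/2 ≤ dim` being expressed as `n ≤ dim + dim`). -/
theorem krull_dim_of_quotient_by_reduced_svs
    {K : Type*} [Field K] [IsAlgClosed K] [CharZero K] {n : ℕ} (hn : 4 ≤ n)
    (h : Fin n → MvPolynomial (Fin n) K) (e : ℕ) (he : 0 < e)
    (hh : ∀ j, (h j).IsHomogeneous e)
    (hsv : ∀ j, ∑ i, h i * pderiv i (h j) = 0)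
    (hred : ∀ p : MvPolynomial (Fin n) K, (∀ j, p ∣ h j) → IsUnit p) :
    (n : WithBot ℕ∞) ≤
        ringKrullDim (MvPolynomial (Fin n) K ⧸ Ideal.span (Set.range h)) +
          ringKrullDim (MvPolynomial (Fin n) K ⧸ Ideal.span (Set.range h)) ∧
      ringKrullDim (MvPolynomial (Fin n) K ⧸ Ideal.span (Set.range h)) ≤
        ((n - 2 : ℕ) : WithBot ℕ∞) := by
  refine ⟨le_ringKrullDim_quotient_add_self h (fun j => ?_)
    (aeval_self_eq_zero_of_self_vanishing h he hh hsv), ?_⟩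
  · rw [MvPolynomial.aeval_zero, constantCoeff_eq, (hh j).coeff_eq_zero (by simpa using he.ne),
      map_zero]
  · have hne : ∃ j, h j ≠ 0 := by
      by_contra! h0
      exact X_ne_zero (R := K) (⟨0, by omega⟩ : Fin n) <|
        (not_isUnit_zero (hred 0 fun j => by rw [h0 j])).elim
    refine ringKrullDim_quotient_le_of_le_height _ ?_ fun P hP hIP =>
      two_le_height_of_forall_dvd_isUnit hne hred P hIP
    rw [MvPolynomial.ringKrullDim_of_isNoetherianRing, ringKrullDim_eq_zero_of_field]
    simp
end

section
/- Let A = (a^{(j)}_i) be a k×n matrix over K (1 ≤ j ≤ k rows, 1 ≤ i ≤ n columns) with k < n, whose rows are linearly independent over K. Then the set Sol(A;R) = { f ∈ K[x₁,…,xₙ] : Σᵢ a^{(j)}ᵢ·(∂f/∂xᵢ) = 0 for all j = 1,…,k } is a K-subalgebra of K[x₁,…,xₙ] which equals the K-subalgebra generated by the (k+1)×(k+1) minors of the (k+1)×n matrix A′ obtained from A by appending the row (x₁,…,xₙ), and Sol(A;R) is isomorphic as a K-algebra to a polynomial ring over K in n−k variables. -/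
open MvPolynomial

/-- A polynomial annihilated by the partial derivatives along the left summand of the variables
only involves variables of the right summand. -/
theorem mem_range_rename_inr_of_pderiv_inl_eq_zero {R σ τ : Type*} [CommRing R] [IsDomain R]
    [CharZero R] {f : MvPolynomial (σ ⊕ τ) R} (hf : ∀ j, pderiv (Sum.inl j) f = 0) :
    f ∈ (rename (R := R) (Sum.inr : τ → σ ⊕ τ)).range := by
  classical
  refine (exists_rename_eq_of_vars_subset_range f Sum.inr Sum.inr_injective ?_).imp
    fun _ h => h
  rintro (j | t) hs
  · exfalso
    obtain ⟨m, hm, hjm⟩ := (mem_vars_iff_mem_support _).mp hs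
    have hle : Finsupp.single (Sum.inl j) 1 ≤ m := by
      simpa [Nat.one_le_iff_ne_zero] using hjm
    have h := coeff_pderiv (i := Sum.inl j) f (m - Finsupp.single (Sum.inl j) 1)
    rw [hf j, coeff_zero, tsub_add_cancel_of_le hle] at h
    exact (mul_ne_zero (mem_support_iff.mp hm) (Nat.cast_add_one_ne_zero _)) h.symm
  · exact ⟨t, rfl⟩

/-- The derivation `∑ i, v i ∂/∂xᵢ`. -/
noncomputable def dirDeriv {R σ : Type*} [CommRing R] [Fintype σ] (v : σ → R) :
    Derivation R (MvPolynomial σ R) (MvPolynomial σ R) :=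
  ∑ i, v i • pderiv i

theorem dirDeriv_apply {R σ : Type*} [CommRing R] [Fintype σ] (v : σ → R)
    (f : MvPolynomial σ R) : dirDeriv v f = ∑ i, v i • pderiv i f := by
  simp only [dirDeriv, ← Derivation.coeFnAddMonoidHom_apply, map_sum, Finset.sum_apply]
  simp

theorem dirDeriv_X {R σ : Type*} [CommRing R] [Fintype σ] (v : σ → R) (i : σ) :
    dirDeriv v (X i) = C (v i) := by
  classical
  rw [dirDeriv_apply, Finset.sum_eq_single i]
  · simp [smul_eq_C_mul]
  · intro b _ hb
    rw [pderiv_X_of_ne hb.symm, smul_zero]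
  · simp

/-- The polynomials annihilated by the derivations in the directions of a family of vectors. -/
noncomputable def constantsOfDirDeriv {R σ ι : Type*} [CommRing R] [Fintype σ] (A : ι → σ → R) :
    Subalgebra R (MvPolynomial σ R) where
  carrier := {f | ∀ j, dirDeriv (A j) f = 0}
  mul_mem' hf hg j := by simp [hf j, hg j]
  add_mem' hf hg j := by simp [hf j, hg j]
  algebraMap_mem' r j := by simp

theorem mem_constantsOfDirDeriv {R σ ι : Type*} [CommRing R] [Fintype σ] {A : ι → σ → R}
    {f : MvPolynomial σ R} : f ∈ constantsOfDirDeriv A ↔ ∀ j, dirDeriv (A j) f = 0 :=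
  Iff.rfl

section CoordinateChange

variable {K σ κ : Type*} [CommRing K] [Fintype σ] [DecidableEq σ] [Fintype κ]

/-- The linear change of coordinates sending the variables to the coordinate forms of a basis. -/
noncomputable def coordEquiv (b : Module.Basis κ K (σ → K)) :
    MvPolynomial κ K ≃ₐ[K] MvPolynomial σ K :=
  AlgEquiv.ofAlgHom (aeval fun t => ∑ i, b.coord t (Pi.single i 1) • X i)
    (aeval fun i => ∑ s, b s i • X s)
    (by
      ext1 i
      have h : ∀ i', ∑ s, b.coord s (Pi.single i' 1) * b s i = if i = i' then 1 else 0 := by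
        intro i'
        have h := congrFun (b.sum_repr (Pi.single i' 1)) i
        simpa [Pi.single_apply] using h
      simp only [AlgHom.comp_apply, aeval_X, map_sum, map_smul, Finset.smul_sum, smul_smul]
      rw [Finset.sum_comm]
      simp only [← Finset.sum_smul, mul_comm (b _ _), h]
      simp)
    (by
      classical
      ext1 t
      have h : ∀ s, ∑ i, b.coord t (Pi.single i 1) * b s i = if s = t then 1 else 0 := by
        intro s
        have h : b.coord t (b s) = if s = t then 1 else 0 := by
          simp [Finsupp.single_apply]
        rw [← h]
        conv_rhs => rw [pi_eq_sum_univ' (b s)]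
        simp [mul_comm]
      simp only [AlgHom.comp_apply, aeval_X, map_sum, map_smul, Finset.smul_sum, smul_smul]
      rw [Finset.sum_comm]
      simp only [← Finset.sum_smul, h]
      simp)

theorem coordEquiv_X (b : Module.Basis κ K (σ → K)) (t : κ) :
    coordEquiv b (X t) = ∑ i, b.coord t (Pi.single i 1) • X i := by
  simp [coordEquiv]

theorem dirDeriv_coordEquiv_X (b : Module.Basis κ K (σ → K)) (v : σ → K) (t : κ) :
    dirDeriv v (coordEquiv b (X t)) = C (b.coord t v) := by
  conv_rhs => rw [pi_eq_sum_univ' v]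
  rw [coordEquiv_X]
  simp [dirDeriv_X, mul_comm, smul_eq_C_mul]

theorem dirDeriv_coordEquiv (b : Module.Basis κ K (σ → K)) (s : κ) (f : MvPolynomial κ K) :
    dirDeriv (b s) (coordEquiv b f) = coordEquiv b (pderiv s f) := by
  classical
  induction f using MvPolynomial.induction_on with
  | C a => simp [coordEquiv]
  | add p q hp hq => simp [hp, hq]
  | mul_X p t hp =>
    rw [map_mul, Derivation.leibniz, Derivation.leibniz, hp, dirDeriv_coordEquiv_X, pderiv_X]
    rcases eq_or_ne t s with rfl | h
    · simp
    · simp [h]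

end CoordinateChange

section Constants

variable {K σ ι τ : Type*} [Field K] [CharZero K] [Fintype σ] [DecidableEq σ] [Fintype ι]
  [Fintype τ] {A : ι → σ → K}

theorem constantsOfDirDeriv_eq_range (b : Module.Basis (ι ⊕ τ) K (σ → K))
    (hb : ∀ j, b (Sum.inl j) = A j) :
    constantsOfDirDeriv A =
      ((coordEquiv b).toAlgHom.comp (rename (R := K) (Sum.inr : τ → ι ⊕ τ))).range := by
  ext f
  obtain ⟨g, rfl⟩ := (coordEquiv b).surjective f
  have h1 : coordEquiv b g ∈ constantsOfDirDeriv A ↔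
      g ∈ (rename (R := K) (Sum.inr : τ → ι ⊕ τ)).range := by
    simp only [mem_constantsOfDirDeriv, ← hb, dirDeriv_coordEquiv, map_eq_zero_iff _
      (coordEquiv b).injective]
    refine ⟨mem_range_rename_inr_of_pderiv_inl_eq_zero, ?_⟩
    rintro ⟨p, rfl⟩ j
    refine pderiv_eq_zero_of_notMem_vars fun h => ?_
    classical
    have := vars_rename _ _ h
    simp at this
  rw [h1, AlgHom.range_comp]
  simp [Subalgebra.mem_map]

/-- The constants are generated by the linear forms whose coefficient vector is orthogonal to
the given directions. -/
theorem constantsOfDirDeriv_le (b : Module.Basis (ι ⊕ τ) K (σ → K))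
    (hb : ∀ j, b (Sum.inl j) = A j) (S : Subalgebra K (MvPolynomial σ K))
    (hS : ∀ u : σ → K, (∀ j, ∑ i, A j i * u i = 0) → ∑ i, u i • X i ∈ S) :
    constantsOfDirDeriv A ≤ S := by
  classical
  rw [constantsOfDirDeriv_eq_range b hb]
  rintro _ ⟨p, rfl⟩
  induction p using MvPolynomial.induction_on with
  | C a => simpa [← algebraMap_eq] using S.algebraMap_mem a
  | add p q hp hq => rw [map_add]; exact S.add_mem hp hq
  | mul_X p t hp =>
    rw [map_mul]
    refine S.mul_mem hp ?_
    have h := hS (fun i => b.coord (Sum.inr t) (Pi.single i 1)) fun j => by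
      have h2 : b.coord (Sum.inr t) (A j) = 0 := by simp [← hb]
      rw [pi_eq_sum_univ' (A j)] at h2
      simpa using h2
    simpa [coordEquiv_X] using h

end Constants

theorem exists_basis_sum_extending {K : Type*} [Field K] {n k : ℕ}
    {A : Fin k → Fin n → K} (hA : LinearIndependent K A) :
    ∃ b : Module.Basis (Fin k ⊕ Fin (n - k)) K (Fin n → K), ∀ j, b (Sum.inl j) = A j := by
  classical
  let b := Module.Basis.sumExtend hA
  have hfin : Finite (Fin k ⊕ Module.Basis.sumExtendIndex hA) := Module.Finite.finite_basis b
  have := Finite.sum_right (β := Module.Basis.sumExtendIndex hA) (Fin k)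
  have hcard : Nat.card (Module.Basis.sumExtendIndex hA) = n - k := by
    have h := Module.finrank_eq_nat_card_basis b
    rw [Nat.card_sum] at h
    simp at h
    simp
    omega
  let e := Finite.equivFinOfCardEq hcard
  refine ⟨b.reindex (Equiv.sumCongr (Equiv.refl _) e), fun j => ?_⟩
  simp only [b, Module.Basis.sumExtend, Module.Basis.reindex_apply,
    Module.Basis.extend_apply_self]
  rfl

/-- Linearly independent rows admit a nonzero maximal minor. -/
theorem exists_det_submatrix_ne_zero {K : Type*} [Field K] {n k : ℕ}
    {A : Fin k → Fin n → K} (hA : LinearIndependent K A) :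
    ∃ e : Fin k → Fin n, ((Matrix.of A).submatrix id e).det ≠ 0 := by
  classical
  obtain ⟨κ, a, ha, hsp, hli⟩ := exists_linearIndependent' K (Matrix.of A).col
  have : Finite κ := Finite.of_injective a ha
  have := Fintype.ofFinite κ
  have hr : (Matrix.of A).rank = k := by
    simpa using LinearIndependent.rank_matrix (M := Matrix.of A) hA
  have hcard : Fintype.card κ = k := by
    rw [← hr, Matrix.rank_eq_finrank_span_cols, ← hsp, finrank_span_eq_card hli]
  let e := (Fintype.equivFinOfCardEq hcard).symm
  refine ⟨a ∘ e, ?_⟩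
  have h := hli.comp e e.injective
  have h2 : IsUnit ((Matrix.of A).submatrix id (a ∘ e)) :=
    Matrix.linearIndependent_cols_iff_isUnit.mp h
  exact ((Matrix.isUnit_iff_isUnit_det _).mp h2).ne_zero

/-- Any `m × m` minor, with columns in arbitrary order and possibly repeated, lies in a subalgebra
containing those with increasing columns. -/
theorem det_submatrix_mem_of_strictMono {K R : Type*} [CommRing K] [CommRing R] [Algebra K R]
    {m n : ℕ} (M : Matrix (Fin m) (Fin n) R) (S : Subalgebra K R)
    (hS : ∀ c : Fin m → Fin n, StrictMono c → (M.submatrix id c).det ∈ S)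
    (c : Fin m → Fin n) : (M.submatrix id c).det ∈ S := by
  by_cases hc : Function.Injective c
  · have h := hS (c ∘ Tuple.sort c)
      ((Tuple.monotone_sort c).strictMono_of_injective (hc.comp (Tuple.sort c).injective))
    have h2 := Matrix.det_permute' (Tuple.sort c) (M.submatrix id c)
    rw [Matrix.submatrix_submatrix] at h2
    simp only [Function.comp_id] at h2
    rw [h2] at h
    rcases Int.units_eq_one_or (Equiv.Perm.sign (Tuple.sort c)) with hs | hs
    · simpa [hs] using h
    · simpa [hs] using h
  · simp only [Function.Injective, not_forall] at hc
    obtain ⟨i, j, hij, hne⟩ := hc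
    rw [Matrix.det_zero_of_column_eq hne (by simp [hij])]
    exact S.zero_mem

section Minors

variable {K : Type*} [Field K] {n k : ℕ} {A : Fin k → Fin n → K}
  {A' : Matrix (Fin (k + 1)) (Fin n) (MvPolynomial (Fin n) K)}

theorem det_submatrix_mem_constantsOfDirDeriv
    (hA' : ∀ c : Fin n, (∀ j : Fin k, A' j.castSucc c = C (A j c)) ∧ A' (Fin.last k) c = X c)
    (c : Fin (k + 1) → Fin n) : (A'.submatrix id c).det ∈ constantsOfDirDeriv A := by
  intro j
  let N : Matrix (Fin (k + 1)) (Fin (k + 1)) (MvPolynomial (Fin n) K) :=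
    (A'.submatrix id c).updateRow (Fin.last k) fun i => C (A j (c i))
  have hN : N.det = 0 := by
    refine Matrix.det_zero_of_row_eq (Fin.castSucc_lt_last j).ne ?_
    ext1 i
    simp [N, (hA' _).1]
  have hsub : ∀ i : Fin (k + 1), ((A'.submatrix id c).submatrix (Fin.last k).succAbove
      i.succAbove).det = C ((Matrix.of A).submatrix id (c ∘ i.succAbove)).det := by
    intro i
    rw [RingHom.map_det]
    congr 1
    ext1 a d
    simp [(hA' _).1]
  rw [← hN, Matrix.det_succ_row _ (Fin.last k), Matrix.det_succ_row N (Fin.last k), map_sum]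
  refine Finset.sum_congr rfl fun i _ => ?_
  have hN2 : N.submatrix (Fin.last k).succAbove i.succAbove =
      (A'.submatrix id c).submatrix (Fin.last k).succAbove i.succAbove := by
    ext1 a d
    simp [N]
  rw [hN2, hsub]
  have hsign : ((-1 : MvPolynomial (Fin n) K) ^ ((Fin.last k : ℕ) + (i : ℕ))) =
      C ((-1) ^ ((Fin.last k : ℕ) + (i : ℕ))) := by simp
  rw [hsign]
  simp [N, (hA' _).2, dirDeriv_X, Derivation.leibniz, ← algebraMap_eq]
  ring

/-- Up to a nonzero constant, a linear form orthogonal to the rows is a combination of minors. -/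
theorem linearForm_mem_of_det_submatrix_mem
    (hA' : ∀ c : Fin n, (∀ j : Fin k, A' j.castSucc c = C (A j c)) ∧ A' (Fin.last k) c = X c)
    (hA : LinearIndependent K A) (S : Subalgebra K (MvPolynomial (Fin n) K))
    (hS : ∀ c : Fin (k + 1) → Fin n, (A'.submatrix id c).det ∈ S)
    (u : Fin n → K) (hu : ∀ j, ∑ i, A j i * u i = 0) :
    ∑ i, u i • (X i : MvPolynomial (Fin n) K) ∈ S := by
  obtain ⟨e, he⟩ := exists_det_submatrix_ne_zero hA
  set d := ((Matrix.of A).submatrix id e).det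
  have hminor : ∀ c : Fin n, (A'.submatrix id (Fin.snoc e c)).det =
      ∑ r : Fin (k + 1), (-1) ^ ((r : ℕ) + k) * A' r c *
        ((A'.submatrix id e).submatrix r.succAbove id).det := by
    intro c
    rw [Matrix.det_succ_column _ (Fin.last k)]
    refine Finset.sum_congr rfl fun r _ => ?_
    congr 2
    · simp
    · ext1 a b
      simp
  have hcol : ∀ r, ∑ c, u c • A' r c = if r = Fin.last k then ∑ i, u i • X i else 0 := by
    intro r
    induction r using Fin.lastCases with
    | last => simp [(hA' _).2]
    | cast j =>
      simp only [(hA' _).1, (Fin.castSucc_lt_last j).ne, if_false, smul_eq_C_mul, ← map_mul,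
        ← map_sum]
      simp [mul_comm (u _), hu]
  have hlast : ((A'.submatrix id e).submatrix (Fin.last k).succAbove id).det = C d := by
    rw [RingHom.map_det]
    congr 1
    ext1 a b
    simp [(hA' _).1]
  have key : ∑ c, u c • (A'.submatrix id (Fin.snoc e c)).det = d • ∑ i, u i • X i := by
    calc _ = ∑ r : Fin (k + 1), (-1) ^ ((r : ℕ) + k) * (∑ c, u c • A' r c) *
        ((A'.submatrix id e).submatrix r.succAbove id).det := by
          simp only [hminor, Finset.smul_sum, Finset.mul_sum, Finset.sum_mul]
          rw [Finset.sum_comm]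
          simp only [mul_smul_comm, smul_mul_assoc]
      _ = d • ∑ i, u i • X i := by
          simp only [hcol]
          rw [Finset.sum_eq_single (Fin.last k)]
          · rw [hlast, if_pos rfl, smul_eq_C_mul, mul_comm (C d)]
            simp [← two_mul]
          · intro r _ hr
            simp [hr]
          · simp
  have h := S.smul_mem (S.sum_mem fun c (_ : c ∈ Finset.univ) =>
    S.smul_mem (hS (Fin.snoc e c)) (u c)) d⁻¹
  rwa [key, inv_smul_smul₀ he] at h

end Minors

/-- Let `A` be a `k × n` matrix over `K` with `k < n` and linearly independent rows.
Then the set of polynomial solutions of the system of differential equations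
`∑ᵢ A j i ∂f/∂xᵢ = 0` (`j = 1,…,k`) is the `K`-subalgebra generated by the
`(k+1) × (k+1)` minors of the matrix `A′` obtained from `A` by appending the row
`(x₁,…,xₙ)`, and this subalgebra is isomorphic to a polynomial ring in `n − k`
variables over `K`. -/
theorem solutions_of_constant_system_eq_adjoin_minors
    {K : Type*} [Field K] [IsAlgClosed K] [CharZero K] {n k : ℕ} (hkn : k < n)
    (A : Fin k → Fin n → K) (hA : LinearIndependent K A)
    (A' : Matrix (Fin (k + 1)) (Fin n) (MvPolynomial (Fin n) K))
    (hA' : ∀ c : Fin n, (∀ j : Fin k, A' j.castSucc c = C (A j c)) ∧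
      A' (Fin.last k) c = X c)
    (minors : Set (MvPolynomial (Fin n) K))
    (hminors : minors = { m | ∃ c : Fin (k + 1) → Fin n, StrictMono c ∧
      m = (A'.submatrix id c).det }) :
    {f : MvPolynomial (Fin n) K | ∀ j : Fin k, ∑ i, A j i • pderiv i f = 0} =
      ↑(Algebra.adjoin K minors) ∧
    Nonempty (↥(Algebra.adjoin K minors) ≃ₐ[K] MvPolynomial (Fin (n - k)) K) := by
  obtain ⟨b, hb⟩ := exists_basis_sum_extending hA
  have hadjoin : constantsOfDirDeriv A = Algebra.adjoin K minors := by
    apply le_antisymm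
    · refine constantsOfDirDeriv_le b hb _ (linearForm_mem_of_det_submatrix_mem hA' hA _
        (det_submatrix_mem_of_strictMono A' _ fun c hc => Algebra.subset_adjoin ?_))
      rw [hminors]
      exact ⟨c, hc, rfl⟩
    · rw [Algebra.adjoin_le_iff, hminors]
      rintro _ ⟨c, -, rfl⟩
      exact det_submatrix_mem_constantsOfDirDeriv hA' c
  rw [← hadjoin]
  refine ⟨?_, ?_⟩
  · ext f
    simp [mem_constantsOfDirDeriv, dirDeriv_apply]
  · rw [constantsOfDirDeriv_eq_range b hb]
    exact ⟨(AlgEquiv.ofInjective _ ((coordEquiv b).injective.comp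
      (rename_injective _ Sum.inr_injective))).symm⟩
end
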